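/- If an enriched matrix A admits a suitable LR-ordering, then the underlying (0,1)-matrix of A contains none of M_0, M_II(4), M_V, nor S_0(k) for any even k >= 4, as a submatrix up to permutations of rows and columns. -/

import Mathlib

/-- Labels for rows of an enriched matrix. -/
inductive RowLabel : Type
  | L | R | LR
deriving DecidableEq

/-- Colors for rows/blocks of an enriched matrix. -/
inductive RowColor : Type
  | red | blue
deriving DecidableEq

/-- An enriched matrix: a (0,1)-matrix whose rows may carry an optional label in
{L, R, LR} and an optional color in {red, blue}, where only L-rows, R-rows and
all-zero LR-rows may be colored, and all colored all-zero LR-rows have the same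
color. -/
structure EnrichedMatrix (m n : ℕ) : Type where
  entry : Fin m → Fin n → Bool
  label : Fin m → Option RowLabel
  color : Fin m → Option RowColor
  color_rows : ∀ i, (color i).isSome = true →
    label i = some RowLabel.L ∨ label i = some RowLabel.R ∨
      (label i = some RowLabel.LR ∧ ∀ j, entry i j = false)
  lr_color_unique : ∀ i k, label i = some RowLabel.LR → label k = some RowLabel.LR →
    (color i).isSome = true → (color k).isSome = true → color i = color k

namespace EnrichedMatrix

variable {m n : ℕ} (A : EnrichedMatrix m n)

/-- Two rows are disjoint: they share no 1-column. -/
def RowDisj (i k : Fin m) : Prop := ∀ j, ¬(A.entry i j = true ∧ A.entry k j = true)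

/-- Row `i` is contained in row `k`. -/
def RowLe (i k : Fin m) : Prop := ∀ j, A.entry i j = true → A.entry k j = true

/-- Two rows are nested: one is contained in the other. -/
def RowNested (i k : Fin m) : Prop := A.RowLe i k ∨ A.RowLe k i

/-- A row is nonempty: it has at least one 1. -/
def RowNonempty (i : Fin m) : Prop := ∃ j, A.entry i j = true

/-- Rows `i` and `k` are both colored, with the same color. -/
def SameColor (i k : Fin m) : Prop := ∃ c, A.color i = some c ∧ A.color k = some c

/-- Rows `i` and `k` are both colored, with distinct colors. -/
def DistinctColors (i k : Fin m) : Prop :=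
  ∃ c d, A.color i = some c ∧ A.color k = some d ∧ c ≠ d

end EnrichedMatrix
namespace EnrichedMatrix

variable {m n : ℕ}

/-- `σ` is an LR-ordering of the columns of `A`: under the column order `σ 0, σ 1, …`,
the 1s of every non-LR-row are consecutive, the 1s of every L-row form an initial
segment, the 1s of every R-row form a final segment, and the 0s of every LR-row are
consecutive. -/
def IsLROrdering (A : EnrichedMatrix m n) (σ : Equiv.Perm (Fin n)) : Prop :=
  (∀ i, A.label i ≠ some RowLabel.LR → ∀ a b c : Fin n, a ≤ b → b ≤ c →
      A.entry i (σ a) = true → A.entry i (σ c) = true → A.entry i (σ b) = true) ∧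
  (∀ i, A.label i = some RowLabel.L → ∀ p q : Fin n, q ≤ p →
      A.entry i (σ p) = true → A.entry i (σ q) = true) ∧
  (∀ i, A.label i = some RowLabel.R → ∀ p q : Fin n, p ≤ q →
      A.entry i (σ p) = true → A.entry i (σ q) = true) ∧
  (∀ i, A.label i = some RowLabel.LR → ∀ a b c : Fin n, a ≤ b → b ≤ c →
      A.entry i (σ a) = false → A.entry i (σ c) = false → A.entry i (σ b) = false)

/-- `A` admits an LR-ordering. -/
def LROrderable (A : EnrichedMatrix m n) : Prop := ∃ σ : Equiv.Perm (Fin n), A.IsLROrdering σ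

/-- Position `p` (w.r.t. the column ordering `σ`) belongs to the L-block of row `i`:
row `i` has 1s in all positions up to and including `p`. -/
def InLBlock (A : EnrichedMatrix m n) (σ : Equiv.Perm (Fin n)) (i : Fin m) (p : Fin n) : Prop :=
  ∀ q : Fin n, q ≤ p → A.entry i (σ q) = true

/-- Position `p` (w.r.t. the column ordering `σ`) belongs to the R-block of row `i`:
row `i` has 1s in all positions from `p` on. -/
def InRBlock (A : EnrichedMatrix m n) (σ : Equiv.Perm (Fin n)) (i : Fin m) (p : Fin n) : Prop :=
  ∀ q : Fin n, p ≤ q → A.entry i (σ q) = true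

/-- Position `p` belongs to the U-block of row `i`: row `i` has a 1 there. -/
def InUBlock (A : EnrichedMatrix m n) (σ : Equiv.Perm (Fin n)) (i : Fin m) (p : Fin n) : Prop :=
  A.entry i (σ p) = true

/-- Row `i` (labeled L or LR) has an L-block w.r.t. `σ`. -/
def HasLBlock (A : EnrichedMatrix m n) (σ : Equiv.Perm (Fin n)) (i : Fin m) : Prop :=
  (A.label i = some RowLabel.L ∨ A.label i = some RowLabel.LR) ∧ ∃ p, A.InLBlock σ i p

/-- Row `i` (labeled R or LR) has an R-block w.r.t. `σ`. -/
def HasRBlock (A : EnrichedMatrix m n) (σ : Equiv.Perm (Fin n)) (i : Fin m) : Prop :=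
  (A.label i = some RowLabel.R ∨ A.label i = some RowLabel.LR) ∧ ∃ p, A.InRBlock σ i p

/-- The LR-ordering `σ` of `A` is suitable: the L-block of each LR-row having exactly
two blocks is disjoint from every R-block, the R-block of each LR-row having exactly
two blocks is disjoint from every L-block, and for each LR-row every U-block is
disjoint from its L-block or disjoint from its R-block. -/
def SuitableLROrdering (A : EnrichedMatrix m n) (σ : Equiv.Perm (Fin n)) : Prop :=
  A.IsLROrdering σ ∧
  (∀ i, A.label i = some RowLabel.LR → A.HasLBlock σ i → A.HasRBlock σ i →
      (∃ p, A.entry i (σ p) = false) →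
      (∀ k, (A.label k = some RowLabel.R ∨ A.label k = some RowLabel.LR) →
        ∀ p, ¬(A.InLBlock σ i p ∧ A.InRBlock σ k p)) ∧
      (∀ k, (A.label k = some RowLabel.L ∨ A.label k = some RowLabel.LR) →
        ∀ p, ¬(A.InRBlock σ i p ∧ A.InLBlock σ k p))) ∧
  (∀ i, A.label i = some RowLabel.LR → ∀ k, A.label k = none →
      (∀ p, ¬(A.InLBlock σ i p ∧ A.InUBlock σ k p)) ∨
      (∀ p, ¬(A.InRBlock σ i p ∧ A.InUBlock σ k p)))

end EnrichedMatrix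

/-- `B` equals a submatrix of `A` up to permutations of rows and columns. -/
def ContainsSub {m n p q : ℕ} (A : Fin m → Fin n → Bool) (B : Fin p → Fin q → Bool) : Prop :=
  ∃ (f : Fin p → Fin m) (g : Fin q → Fin n),
    Function.Injective f ∧ Function.Injective g ∧ ∀ i j, B i j = A (f i) (g j)

/-- The matrix `M_0`, with rows 1011, 1110, 0111. -/
def M0mat : Fin 3 → Fin 4 → Bool :=
  ![![true, false, true, true], ![true, true, true, false], ![false, true, true, true]]

/-- The matrix `M_II(4)`, with rows 0111, 1100, 0110, 1101. -/
def MII4 : Fin 4 → Fin 4 → Bool :=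
  ![![false, true, true, true], ![true, true, false, false],
    ![false, true, true, false], ![true, true, false, true]]

/-- The matrix `M_V`, with rows 11000, 00110, 11110, 10011. -/
def MV : Fin 4 → Fin 5 → Bool :=
  ![![true, true, false, false, false], ![false, false, true, true, false],
    ![true, true, true, true, false], ![true, false, false, true, true]]

/-- The matrix `S_0(k)`: first row all 1s, row `i+1` (for `1 ≤ i ≤ k-1`) with 1s in
columns `i`, `i+1` (1-indexed), and last row with 1s in columns `1` and `k`. -/
def S0 (k : ℕ) : Fin (k + 1) → Fin k → Bool := fun i j =>
  if i.val = 0 then true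
  else if i.val = k then decide (j.val = 0 ∨ j.val = k - 1)
  else decide (j.val = i.val - 1 ∨ j.val = i.val)

namespace EnrichedMatrix

variable {m n : ℕ}

/-- A row of a matrix with an LR-ordering has no alternating pattern `1010`. -/
theorem IsLROrdering.not_one_zero_one_zero {A : EnrichedMatrix m n} {σ : Equiv.Perm (Fin n)}
    (h : A.IsLROrdering σ) (i : Fin m) {p q r s : Fin n} (hpq : p < q) (hqr : q < r) (hrs : r < s)
    (hp : A.entry i (σ p) = true) (hq : A.entry i (σ q) = false)
    (hr : A.entry i (σ r) = true) (hs : A.entry i (σ s) = false) : False := by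
  obtain ⟨hU, -, -, hLR⟩ := h
  by_cases hi : A.label i = some RowLabel.LR
  · simp [hLR i hi q r s hqr.le hrs.le hq hs] at hr
  · simp [hU i hi p q r hpq.le hqr.le hp hr] at hq

/-- A row of a matrix with an LR-ordering has no alternating pattern `0101`. -/
theorem IsLROrdering.not_zero_one_zero_one {A : EnrichedMatrix m n} {σ : Equiv.Perm (Fin n)}
    (h : A.IsLROrdering σ) (i : Fin m) {p q r s : Fin n} (hpq : p < q) (hqr : q < r) (hrs : r < s)
    (hp : A.entry i (σ p) = false) (hq : A.entry i (σ q) = true)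
    (hr : A.entry i (σ r) = false) (hs : A.entry i (σ s) = true) : False := by
  obtain ⟨hU, -, -, hLR⟩ := h
  by_cases hi : A.label i = some RowLabel.LR
  · simp [hLR i hi p q r hpq.le hqr.le hp hr] at hq
  · simp [hU i hi q r s hqr.le hrs.le hq hs] at hr

/-- With respect to a suitable LR-ordering, if two rows share 1s at positions `x` and `r`, and one
of them has a 0 strictly between these positions, then so does the other. -/
theorem SuitableLROrdering.exists_zero_between {A : EnrichedMatrix m n}
    {σ : Equiv.Perm (Fin n)} (h : A.SuitableLROrdering σ) {i k : Fin m} {x q r : Fin n}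
    (hxq : x < q) (hqr : q < r) (hkx : A.entry k (σ x) = true) (hkq : A.entry k (σ q) = false)
    (hkr : A.entry k (σ r) = true) (hix : A.entry i (σ x) = true)
    (hir : A.entry i (σ r) = true) : ∃ t, x < t ∧ t < r ∧ A.entry i (σ t) = false := by
  obtain ⟨⟨hU, hL, hR, hLR⟩, hblock, hdisj⟩ := h
  have hk : A.label k = some RowLabel.LR := by
    by_contra hk
    simp [hU k hk x q r hxq.le hqr.le hkx hkr] at hkq
  have hkL : A.InLBlock σ k x := by
    intro t ht
    by_contra hkt
    simp [hLR k hk t x q ht hxq.le (by simpa using hkt) hkq] at hkx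
  have hkR : A.InRBlock σ k r := by
    intro t ht
    by_contra hkt
    simp [hLR k hk q r t hqr.le ht hkq (by simpa using hkt)] at hkr
  obtain ⟨hnR, hnL⟩ := hblock k hk ⟨Or.inr hk, x, hkL⟩ ⟨Or.inr hk, r, hkR⟩ ⟨q, hkq⟩
  match hi : A.label i with
  | none =>
    rcases hdisj k hk i hi with hd | hd
    · exact (hd x ⟨hkL, hix⟩).elim
    · exact (hd r ⟨hkR, hir⟩).elim
  | some RowLabel.L => exact (hnL i (Or.inl hi) r ⟨hkR, fun t ht => hL i hi r t ht hir⟩).elim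
  | some RowLabel.R => exact (hnR i (Or.inl hi) x ⟨hkL, fun t ht => hR i hi x t ht hix⟩).elim
  | some RowLabel.LR =>
    have h₁ : ∃ t, t ≤ r ∧ A.entry i (σ t) = false := by
      by_contra! hc
      exact hnL i (Or.inr hi) r ⟨hkR, fun t ht => by simpa using hc t ht⟩
    have h₂ : ∃ t, x ≤ t ∧ A.entry i (σ t) = false := by
      by_contra! hc
      exact hnR i (Or.inr hi) x ⟨hkL, fun t ht => by simpa using hc t ht⟩
    obtain ⟨t, htr, ht⟩ := h₁
    obtain ⟨t', hxt', ht'⟩ := h₂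
    have hne : ∀ {y}, A.entry i (σ y) = false → y ≠ x ∧ y ≠ r := by
      intro y hy
      constructor <;> rintro rfl <;> simp_all
    rcases le_total x t with hxt | htx
    · exact ⟨t, lt_of_le_of_ne hxt (hne ht).1.symm, lt_of_le_of_ne htr (hne ht).2, ht⟩
    · simp [hLR i hi t x t' htx hxt' ht ht'] at hix

/-- The pairs `{a, c}` and `{b, d}` separate each other in the cyclic order. -/
def Separates (a c b d : Fin n) : Prop :=
  (a < b ∧ b < c ∧ c < d) ∨ (a < d ∧ d < c ∧ c < b) ∨ (c < b ∧ b < a ∧ a < d) ∨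
  (c < d ∧ d < a ∧ a < b) ∨ (b < c ∧ c < d ∧ d < a) ∨ (b < a ∧ a < d ∧ d < c) ∨
  (d < c ∧ c < b ∧ b < a) ∨ (d < a ∧ a < b ∧ b < c)

theorem Separates.comm {a c b d : Fin n} (h : Separates a c b d) : Separates b d a c := by
  unfold Separates
  rcases h with (h | h | h | h | h | h | h | h) <;> simp [h]

theorem Separates.swap {a c b d : Fin n} (h : Separates a c b d) : Separates c a b d := by
  unfold Separates
  rcases h with (h | h | h | h | h | h | h | h) <;> simp [h]

/-- Among the three ways to split four distinct elements into two pairs, there is one such that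
the pairs separate each other. -/
theorem exists_separates {a b c d : Fin n} (hab : a ≠ b) (hac : a ≠ c) (had : a ≠ d)
    (hbc : b ≠ c) (hbd : b ≠ d) (hcd : c ≠ d) :
    Separates a b c d ∨ Separates a c b d ∨ Separates a d b c := by
  unfold Separates
  rcases lt_or_gt_of_ne hab with h₁ | h₁ <;> rcases lt_or_gt_of_ne hac with h₂ | h₂ <;>
  rcases lt_or_gt_of_ne had with h₃ | h₃ <;> rcases lt_or_gt_of_ne hbc with h₄ | h₄ <;>
  rcases lt_or_gt_of_ne hbd with h₅ | h₅ <;> rcases lt_or_gt_of_ne hcd with h₆ | h₆ <;>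
  simp [h₁, h₂, h₃, h₄, h₅, h₆, h₁.not_gt, h₂.not_gt, h₃.not_gt, h₄.not_gt, h₅.not_gt,
    h₆.not_gt]

/-- Not being separated by the pair `{a, c}` is transitive. -/
theorem not_separates_trans {a c x y z : Fin n} (hya : y ≠ a) (hyc : y ≠ c)
    (hxy : ¬ Separates a c x y) (hyz : ¬ Separates a c y z) : ¬ Separates a c x z := by
  rintro (⟨h₁, h₂, h₃⟩ | ⟨h₁, h₂, h₃⟩ | ⟨h₁, h₂, h₃⟩ | ⟨h₁, h₂, h₃⟩ |
    ⟨h₁, h₂, h₃⟩ | ⟨h₁, h₂, h₃⟩ | ⟨h₁, h₂, h₃⟩ | ⟨h₁, h₂, h₃⟩) <;>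
  · unfold Separates at hxy hyz
    grind

/-- With respect to an LR-ordering, the 1s of a row never separate its 0s. -/
theorem IsLROrdering.not_separates {A : EnrichedMatrix m n} {σ : Equiv.Perm (Fin n)}
    (h : A.IsLROrdering σ) (i : Fin m) {a c b d : Fin n}
    (ha : A.entry i (σ a) = true) (hc : A.entry i (σ c) = true)
    (hb : A.entry i (σ b) = false) (hd : A.entry i (σ d) = false) : ¬ Separates a c b d := by
  rintro (⟨h₁, h₂, h₃⟩ | ⟨h₁, h₂, h₃⟩ | ⟨h₁, h₂, h₃⟩ | ⟨h₁, h₂, h₃⟩ |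
    ⟨h₁, h₂, h₃⟩ | ⟨h₁, h₂, h₃⟩ | ⟨h₁, h₂, h₃⟩ | ⟨h₁, h₂, h₃⟩)
  · exact h.not_one_zero_one_zero i h₁ h₂ h₃ ha hb hc hd
  · exact h.not_one_zero_one_zero i h₁ h₂ h₃ ha hd hc hb
  · exact h.not_one_zero_one_zero i h₁ h₂ h₃ hc hb ha hd
  · exact h.not_one_zero_one_zero i h₁ h₂ h₃ hc hd ha hb
  · exact h.not_zero_one_zero_one i h₁ h₂ h₃ hb hc hd ha
  · exact h.not_zero_one_zero_one i h₁ h₂ h₃ hb ha hd hc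
  · exact h.not_zero_one_zero_one i h₁ h₂ h₃ hd hc hb ha
  · exact h.not_zero_one_zero_one i h₁ h₂ h₃ hd ha hb hc

/-- With respect to a suitable LR-ordering, two rows sharing 1s in columns `b` and `d` cannot have
single 0s among four columns at `a` and `c` respectively if `{a, c}` separates `{b, d}`. -/
theorem SuitableLROrdering.not_separates {A : EnrichedMatrix m n} {σ : Equiv.Perm (Fin n)}
    (h : A.SuitableLROrdering σ) {i k : Fin m} {a b c d : Fin n}
    (hia : A.entry i (σ a) = false) (hib : A.entry i (σ b) = true)
    (hid : A.entry i (σ d) = true) (hkb : A.entry k (σ b) = true)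
    (hkc : A.entry k (σ c) = false) (hkd : A.entry k (σ d) = true) : ¬ Separates a c b d := by
  have left : ∀ {i k : Fin m} {p q r s : Fin n}, p < q → q < r → r < s →
      A.entry i (σ p) = false → A.entry i (σ q) = true → A.entry i (σ s) = true →
      A.entry k (σ q) = true → A.entry k (σ r) = false → A.entry k (σ s) = true → False := by
    intro i k p q r s hpq hqr hrs hip hiq his hkq hkr hks
    obtain ⟨t, hqt, hts, ht⟩ := h.exists_zero_between hqr hrs hkq hkr hks hiq his
    exact h.1.not_zero_one_zero_one i hpq hqt hts hip hiq ht his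
  have right : ∀ {i k : Fin m} {p q r s : Fin n}, p < q → q < r → r < s →
      A.entry i (σ p) = true → A.entry i (σ r) = true → A.entry i (σ s) = false →
      A.entry k (σ p) = true → A.entry k (σ q) = false → A.entry k (σ r) = true → False := by
    intro i k p q r s hpq hqr hrs hip hir his hkp hkq hkr
    obtain ⟨t, hpt, htr, ht⟩ := h.exists_zero_between hpq hqr hkp hkq hkr hip hir
    exact h.1.not_one_zero_one_zero i hpt htr hrs hip ht hir his
  rintro (⟨h₁, h₂, h₃⟩ | ⟨h₁, h₂, h₃⟩ | ⟨h₁, h₂, h₃⟩ | ⟨h₁, h₂, h₃⟩ |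
    ⟨h₁, h₂, h₃⟩ | ⟨h₁, h₂, h₃⟩ | ⟨h₁, h₂, h₃⟩ | ⟨h₁, h₂, h₃⟩)
  · exact left h₁ h₂ h₃ hia hib hid hkb hkc hkd
  · exact left h₁ h₂ h₃ hia hid hib hkd hkc hkb
  · exact left h₁ h₂ h₃ hkc hkb hkd hib hia hid
  · exact left h₁ h₂ h₃ hkc hkd hkb hid hia hib
  · exact right h₁ h₂ h₃ hib hid hia hkb hkc hkd
  · exact right h₁ h₂ h₃ hkb hkd hkc hib hia hid
  · exact right h₁ h₂ h₃ hid hib hia hkd hkc hkb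
  · exact right h₁ h₂ h₃ hkd hkb hkc hid hia hib

/-- A suitable LR-ordering does not allow a cycle of rows, each with 1s exactly at two cyclically
consecutive columns, together with a row that is all 1s on these columns. -/
theorem SuitableLROrdering.not_cycle {A : EnrichedMatrix m n} {σ : Equiv.Perm (Fin n)}
    (h : A.SuitableLROrdering σ) {k : ℕ} [NeZero k] (hk : 3 ≤ k) (c : ZMod k → Fin n)
    (hc : Function.Injective c) (E : ZMod k → Fin m) (a : Fin m)
    (ha : ∀ s, A.entry a (σ (c s)) = true)
    (hE : ∀ t s, A.entry (E t) (σ (c s)) = true ↔ s = t ∨ s = t + 1) : False := by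
  have htwo : ∀ t : ZMod k, t + 1 + 1 ≠ t := by
    intro t ht
    have h2 : ((2 : ℕ) : ZMod k) = 0 := by
      push_cast
      linear_combination ht
    rw [ZMod.natCast_eq_zero_iff] at h2
    have := Nat.le_of_dvd (by norm_num) h2
    omega
  have hone : ∀ t : ZMod k, t + 1 ≠ t := by
    intro t ht
    exact htwo t (by rw [ht, ht])
  have hE0 : ∀ t s, s ≠ t → s ≠ t + 1 → A.entry (E t) (σ (c s)) = false := by
    intro t s h₁ h₂
    rw [← Bool.not_eq_true, hE]
    tauto
  -- The all-1s row has a 0 between two of the columns.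
  obtain ⟨z, u, v, hz, hu, hv⟩ : ∃ z u v, A.entry a (σ z) = false ∧ c u < z ∧ z < c v := by
    obtain ⟨u, hu⟩ := Finite.exists_min c
    have hlt : ∀ s, s ≠ u → c u < c s := fun s hs =>
      lt_of_le_of_ne (hu s) fun h' => hs (hc h').symm
    have hpred : u - 1 ≠ u := fun h' => hone u (by linear_combination -h')
    have hne : u - 1 ≠ u + 1 := fun h' => htwo u (by linear_combination -h')
    rcases lt_or_gt_of_ne (hc.ne hne) with hlt' | hlt'
    · obtain ⟨z, h₁, h₂, hz⟩ := h.exists_zero_between (hlt _ hpred) hlt'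
        ((hE u u).2 (Or.inl rfl)) (hE0 _ _ hpred hne) ((hE u (u + 1)).2 (Or.inr rfl))
        (ha u) (ha (u + 1))
      exact ⟨z, _, _, hz, h₁, h₂⟩
    · obtain ⟨z, h₁, h₂, hz⟩ := h.exists_zero_between (hlt _ (hone u)) hlt'
        ((hE (u - 1) u).2 (Or.inr (by ring))) (hE0 _ _ hne.symm (by simpa using hone u))
        ((hE (u - 1) (u - 1)).2 (Or.inl rfl)) (ha u) (ha (u - 1))
      exact ⟨z, _, _, hz, h₁, h₂⟩
  have hside : ∀ s, ¬ c s < z → z < c s := by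
    intro s hs
    refine lt_of_le_of_ne (not_lt.1 hs) ?_
    rintro rfl
    simp [ha s] at hz
  have hstep : ∀ P : ZMod k → Prop, ∀ x y, P x → ¬ P y → ∃ t, P t ∧ ¬ P (t + 1) := by
    intro P x y hx hy
    by_contra! hP
    have hall : ∀ j : ℕ, P (x + j) := by
      intro j
      induction j with
      | zero => simpa using hx
      | succ j ih => simpa [add_assoc] using hP _ ih
    exact hy (by simpa using hall (y - x).val)
  -- A cycle edge across that 0 joins the first and the last of the columns.
  have hext : ∀ t x y, (x = t ∧ y = t + 1 ∨ x = t + 1 ∧ y = t) → c x < z → z < c y →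
      ∀ s, s ≠ x → s ≠ y → c x < c s ∧ c s < c y := by
    intro t x y hxy hx hy s hsx hsy
    have hex : A.entry (E t) (σ (c x)) = true := (hE t x).2 (by tauto)
    have hey : A.entry (E t) (σ (c y)) = true := (hE t y).2 (by tauto)
    have hes : A.entry (E t) (σ (c s)) = false := by
      rcases hxy with ⟨rfl, rfl⟩ | ⟨rfl, rfl⟩
      · exact hE0 _ _ hsx hsy
      · exact hE0 _ _ hsy hsx
    obtain ⟨w, hw₁, hw₂, hw⟩ := h.exists_zero_between hx hy (ha x) hz (ha y) hex hey
    constructor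
    · by_contra hlt
      exact h.1.not_zero_one_zero_one _ (lt_of_le_of_ne (not_lt.1 hlt) (hc.ne hsx)) hw₁ hw₂
        hes hex hw hey
    · by_contra hlt
      exact h.1.not_one_zero_one_zero _ hw₁ hw₂ (lt_of_le_of_ne (not_lt.1 hlt) (hc.ne hsy.symm))
        hex hw hey hes
  obtain ⟨t, ht, ht'⟩ := hstep (fun s => c s < z) u v hu hv.not_gt
  obtain ⟨t', hs, hs'⟩ := hstep (fun s => ¬ c s < z) v u hv.not_gt (not_not.2 hu)
  rw [not_not] at hs'
  replace ht' := hside _ ht'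
  replace hs := hside _ hs
  have e₁ := hext t t (t + 1) (Or.inl ⟨rfl, rfl⟩) ht ht'
  have e₂ := hext t' (t' + 1) t' (Or.inr ⟨rfl, rfl⟩) hs' hs
  have hfirst : t = t' + 1 := by
    by_contra hne
    exact lt_asymm (e₁ (t' + 1) (Ne.symm hne) fun h' => lt_asymm (h' ▸ hs') ht').1
      (e₂ t hne fun h' => lt_asymm (h' ▸ ht) hs).1
  have hlast : t + 1 = t' := by
    by_contra hne
    exact lt_asymm (e₁ t' (fun h' => lt_asymm (h' ▸ hs) ht) (Ne.symm hne)).2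
      (e₂ (t + 1) (fun h' => lt_asymm (h' ▸ ht') hs') hne).2
  exact htwo t (by rw [hlast, hfirst])

end EnrichedMatrix

/-- If an enriched matrix admits a suitable LR-ordering, then its underlying
(0,1)-matrix contains none of `M_0`, `M_II(4)`, `M_V`, nor `S_0(k)` for any even
`k ≥ 4`, as a submatrix up to permutations of rows and columns. -/
theorem suitable_no_forbidden {m n : ℕ} (A : EnrichedMatrix m n)
    (σ : Equiv.Perm (Fin n)) (h : A.SuitableLROrdering σ) :
    ¬ ContainsSub A.entry M0mat ∧ ¬ ContainsSub A.entry MII4 ∧ ¬ ContainsSub A.entry MV ∧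
      ∀ k : ℕ, 4 ≤ k → Even k → ¬ ContainsSub A.entry (S0 k) := by
  have key : ∀ {p q : ℕ} {B : Fin p → Fin q → Bool}, ContainsSub A.entry B →
      ∃ (f : Fin p → Fin m) (c : Fin q → Fin n), Function.Injective c ∧
        ∀ i j, A.entry (f i) (σ (c j)) = B i j := by
    rintro p q B ⟨f, g, -, hg, hB⟩
    exact ⟨f, fun j => σ.symm (g j), σ.symm.injective.comp hg, fun i j => by simp [hB]⟩
  refine ⟨fun hsub => ?_, fun hsub => ?_, fun hsub => ?_, fun k hk _ hsub => ?_⟩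
  · obtain ⟨f, c, hc, hB⟩ := key hsub
    have n₁ := h.not_separates (hB 0 1) (hB 0 0) (hB 0 2) (hB 1 0) (hB 1 3) (hB 1 2)
    have n₂ := h.not_separates (hB 0 1) (hB 0 3) (hB 0 2) (hB 2 3) (hB 2 0) (hB 2 2)
    have n₃ := h.not_separates (hB 1 3) (hB 1 1) (hB 1 2) (hB 2 1) (hB 2 0) (hB 2 2)
    rcases EnrichedMatrix.exists_separates (hc.ne (show (1 : Fin 4) ≠ 3 by decide))
      (hc.ne (show _ ≠ 0 by decide)) (hc.ne (show _ ≠ 2 by decide)) (hc.ne (by decide))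
      (hc.ne (by decide)) (hc.ne (by decide)) with hs | hs | hs
    · exact n₁ hs
    · exact n₂ hs
    · exact n₃ hs.comm
  · obtain ⟨f, c, hc, hB⟩ := key hsub
    have n₁ := h.not_separates (hB 0 0) (hB 0 1) (hB 0 3) (hB 3 1) (hB 3 2) (hB 3 3)
    have n₂ := h.1.not_separates _ (hB 1 0) (hB 1 1) (hB 1 2) (hB 1 3)
    have n₃ := h.1.not_separates _ (hB 2 1) (hB 2 2) (hB 2 0) (hB 2 3)
    rcases EnrichedMatrix.exists_separates (hc.ne (show (0 : Fin 4) ≠ 1 by decide))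
      (hc.ne (show _ ≠ 2 by decide)) (hc.ne (show _ ≠ 3 by decide)) (hc.ne (by decide))
      (hc.ne (by decide)) (hc.ne (by decide)) with hs | hs | hs
    · exact n₂ hs
    · exact n₁ hs
    · exact n₃ hs.comm
  · obtain ⟨f, c, hc, hB⟩ := key hsub
    have n₁ := h.not_separates (hB 2 4) (hB 2 0) (hB 2 3) (hB 3 0) (hB 3 1) (hB 3 3)
    have n₂ := h.1.not_separates _ (hB 0 0) (hB 0 1) (hB 0 3) (hB 0 4)
    have n₃ := h.1.not_separates _ (hB 3 0) (hB 3 4) (hB 3 1) (hB 3 2)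
    have n₄ : ¬ EnrichedMatrix.Separates (c 0) (c 4) (c 2) (c 3) := fun hs =>
      h.1.not_separates _ (hB 1 2) (hB 1 3) (hB 1 0) (hB 1 4) hs.comm
    have n₅ := EnrichedMatrix.not_separates_trans (hc.ne (by decide)) (hc.ne (by decide)) n₃ n₄
    rcases EnrichedMatrix.exists_separates (hc.ne (show (0 : Fin 5) ≠ 1 by decide))
      (hc.ne (show _ ≠ 3 by decide)) (hc.ne (show _ ≠ 4 by decide)) (hc.ne (by decide))
      (hc.ne (by decide)) (hc.ne (by decide)) with hs | hs | hs
    · exact n₂ hs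
    · exact n₁ hs.comm.swap
    · exact n₅ hs
  · obtain ⟨f, c, hc, hB⟩ := key hsub
    have : NeZero k := ⟨by omega⟩
    refine h.not_cycle (by omega : 3 ≤ k) (fun s => c ⟨s.val, ZMod.val_lt s⟩) ?_
      (fun t => f ⟨t.val + 1, Nat.succ_lt_succ (ZMod.val_lt t)⟩) (f 0) ?_ ?_
    · intro s t hst
      exact ZMod.val_injective k (by simpa using hc hst)
    · intro s
      simp [hB, S0]
    · intro t s
      have hs := ZMod.val_lt s
      have ht := ZMod.val_lt t
      have hval : (t + 1).val = if t.val + 1 = k then 0 else t.val + 1 := by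
        rw [ZMod.val_add, ZMod.val_one'' (by omega)]
        split_ifs with hk'
        · simp [hk']
        · exact Nat.mod_eq_of_lt (by omega)
      rw [hB, ← (ZMod.val_injective k).eq_iff, ← (ZMod.val_injective k).eq_iff (b := t + 1), hval]
      unfold S0
      rw [if_neg (Nat.succ_ne_zero _)]
      dsimp only
      split_ifs <;> rw [decide_eq_true_eq] <;> omega
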